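/- arXiv:1511.03909 — 2 statements merged into one kernel-verified Lean document; each statement's English description precedes it below -/
import Mathlib

section
/- Let N > 1 be an odd integer and let b, c be real constants with c ≠ 0, and let g : ℕ × ℝ → ℝ be continuous in its second variable and N-periodic in its first variable (g(t+N,x) = g(t,x) for all t, x). Suppose there are positive constants r, ẑ, δ such that: (C1) |g(t,x)| ≤ δ for all t ∈ ℕ and all x ∈ [−2r, 2r]; (C2) x·g(t,x) > 0 for all t ∈ ℕ and all x with |x| > ẑ; (C3) ẑ + ‖M_p ∘ (I − Q)‖·δ < r; (C4) if N·arccos(−b/2) is an integer multiple of 2π, then c ≠ 1 or |b| ≥ 2. Then there exists an N-periodic function y : ℕ → ℝ (y(t+N) = y(t) for all t) satisfying y(t+2) + b·y(t+1) + c·y(t) = g(t, y(t)) for all t ∈ ℕ. -/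
open Matrix

/-- The Euclidean norm of a vector in `ℝ²`. -/
noncomputable def euclNorm2 (v : Fin 2 → ℝ) : ℝ := Real.sqrt (v 0 ^ 2 + v 1 ^ 2)

/-- The supremum norm on functions `ℕ → ℝ²` (with the Euclidean norm on `ℝ²`). -/
noncomputable def supNorm (x : ℕ → Fin 2 → ℝ) : ℝ := ⨆ t : ℕ, euclNorm2 (x t)

/-- A bounded continuous self-map of the complex plane has a fixed point. -/
theorem Complex.exists_fixedPoint_of_bounded {f : ℂ → ℂ} (hf : Continuous f) {R : ℝ}
    (hR : ∀ p, ‖f p‖ ≤ R) : ∃ p, f p = p := by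
  by_contra! hne
  have hR0 : 0 ≤ R := (norm_nonneg _).trans (hR 0)
  -- a continuous logarithm of the nonvanishing displacement
  let h : C(ℂ, ℂ) := ⟨fun p => p - f p, by fun_prop⟩
  have hh : ∀ p, h p ∈ ({0}ᶜ : Set ℂ) := fun p =>
    sub_ne_zero.2 (hne p).symm
  obtain ⟨F, ⟨-, hF⟩, -⟩ := Complex.isCoveringMapOn_exp.existsUnique_continuousMap_lifts h
    (a₀ := 0) (e₀ := Complex.log (h 0)) (Complex.exp_log (hh 0)) hh
  have hF' : ∀ p, Complex.exp (F p) = p - f p := fun p => congrFun hF p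
  let S : ℝ := R + 1
  have hS : 0 < S := by positivity
  let γ : ℝ → ℂ := fun θ => S * Complex.exp (θ * Complex.I)
  have hγ : Continuous γ := by fun_prop
  have hγne : ∀ θ, γ θ ≠ 0 := fun θ =>
    mul_ne_zero (by exact_mod_cast hS.ne') (Complex.exp_ne_zero _)
  have hγnorm : ∀ θ, ‖γ θ‖ = S := fun θ => by
    simp [γ, Complex.norm_exp_ofReal_mul_I, abs_of_pos hS]
  let q : ℝ → ℂ := fun θ => 1 - f (γ θ) / γ θ
  have hq : Continuous q := by
    have := hf.comp hγ
    exact continuous_const.sub (this.div hγ hγne)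
  have hqs : ∀ θ, q θ ∈ Complex.slitPlane := fun θ => by
    have hlt : ‖f (γ θ) / γ θ‖ < 1 := by
      rw [norm_div, hγnorm, div_lt_one hS]
      exact (hR _).trans_lt (lt_add_one R)
    left
    have := (Complex.re_le_norm (f (γ θ) / γ θ)).trans_lt hlt
    simp only [q, Complex.sub_re, Complex.one_re]
    linarith
  have hγq : ∀ θ, γ θ * q θ = γ θ - f (γ θ) := fun θ => by
    simp only [q]; field_simp [hγne θ]
  -- the difference of two logarithms of `γ` is continuous with values in `2πiℤ`
  let d : ℝ → ℂ := fun θ => F (γ θ) - Complex.log (q θ) - θ * Complex.I - Real.log S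
  have hd : Continuous d := by
    have h1 : Continuous fun θ => F (γ θ) := F.continuous.comp hγ
    have h2 : Continuous fun θ => Complex.log (q θ) := hq.clog hqs
    fun_prop
  have hdexp : ∀ θ, Complex.exp (d θ) = 1 := fun θ => by
    simp only [d]
    rw [Complex.exp_sub, Complex.exp_sub, Complex.exp_sub, hF', ← hγq,
      Complex.exp_log (Complex.slitPlane_ne_zero (hqs θ)), ← Complex.ofReal_exp, Real.exp_log hS]
    have := Complex.slitPlane_ne_zero (hqs θ)
    have hS' : (S : ℂ) ≠ 0 := by exact_mod_cast hS.ne'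
    simp only [γ]
    field_simp [Complex.exp_ne_zero]
  choose n hn using fun θ => Complex.exp_eq_one_iff.1 (hdexp θ)
  have hnn : ∀ θ, ((n θ : ℤ) : ℝ) = (d θ).im / (2 * Real.pi) := fun θ => by
    rw [hn θ]; simp [Real.pi_ne_zero]
  have hnc : Continuous n := by
    rw [Int.isClosedEmbedding_coe_real.isEmbedding.continuous_iff]
    have : ((fun k : ℤ => (k : ℝ)) ∘ n) = fun θ => (d θ).im / (2 * Real.pi) := funext hnn
    rw [this]
    fun_prop
  have hconst : n 0 = n (2 * Real.pi) := PreconnectedSpace.constant inferInstance hnc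
  have hper : γ (2 * Real.pi) = γ 0 := by
    simp [γ, Complex.exp_two_pi_mul_I]
  have hdd : d 0 = d (2 * Real.pi) := by rw [hn, hn, hconst]
  simp only [d, q, hper] at hdd
  have := congrArg Complex.im hdd
  simp at this
  linarith [Real.pi_pos]

/-- A bounded continuous self-map of `ℝ²` has a fixed point. -/
theorem exists_fixedPoint_of_bounded_fin_two {f : (Fin 2 → ℝ) → Fin 2 → ℝ} (hf : Continuous f)
    {R : ℝ} (hR : ∀ p i, |f p i| ≤ R) : ∃ p, f p = p := by
  obtain ⟨p, hp⟩ := Complex.exists_fixedPoint_of_bounded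
    (f := fun p => (f ![p.re, p.im] 0 : ℂ) + f ![p.re, p.im] 1 * Complex.I) (R := R + R)
    (by
      have h : Continuous fun p : ℂ => f ![p.re, p.im] := by
        refine hf.comp (continuous_pi fun i => ?_)
        fin_cases i
        · exact Complex.continuous_re
        · exact Complex.continuous_im
      have h0 := (continuous_apply (0 : Fin 2)).comp h
      have h1 := (continuous_apply (1 : Fin 2)).comp h
      simp only [Function.comp_def] at h0 h1
      fun_prop)
    fun p => by
      refine (norm_add_le _ _).trans (add_le_add ?_ ?_) <;> simp [hR]
  refine ⟨![p.re, p.im], funext fun i => ?_⟩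
  have hre := congrArg Complex.re hp
  have him := congrArg Complex.im hp
  fin_cases i
  · simpa using hre
  · simpa using him

/-- If `1 - A ^ N` is invertible, every bounded continuous `N`-periodic perturbation of the linear
recursion with companion matrix `A` has an `N`-periodic solution. -/
theorem exists_periodic_solution_of_det_ne_zero {N : ℕ} {b c : ℝ}
    (hdet : (1 - (!![0, 1; -c, -b] : Matrix (Fin 2) (Fin 2) ℝ) ^ N).det ≠ 0)
    {g : ℕ → ℝ → ℝ} (hg : ∀ t, Continuous (g t)) (hper : ∀ t x, g (t + N) x = g t x)
    {D : ℝ} (hD : ∀ t x, |g t x| ≤ D) :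
    ∃ y : ℕ → ℝ, (∀ t, y (t + N) = y t) ∧
      ∀ t, y (t + 2) + b * y (t + 1) + c * y t = g t (y t) := by
  set A : Matrix (Fin 2) (Fin 2) ℝ := !![0, 1; -c, -b] with hA
  -- the orbit starting from `p`
  let x : (Fin 2 → ℝ) → ℕ → Fin 2 → ℝ := fun p t =>
    Nat.rec p (fun t v => A *ᵥ v + ![0, g t (v 0)]) t
  have hx0 : ∀ p, x p 0 = p := fun _ => rfl
  have hxs : ∀ p t, x p (t + 1) = A *ᵥ x p t + ![0, g t (x p t 0)] := fun _ _ => rfl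
  have hxc : ∀ t, Continuous fun p => x p t := by
    intro t
    induction t with
    | zero => exact continuous_id
    | succ t ih =>
      simp only [hxs]
      refine (Continuous.matrix_mulVec continuous_const ih).add (continuous_pi fun i => ?_)
      fin_cases i
      · exact continuous_const
      · exact (hg t).comp ((continuous_apply 0).comp ih)
  have hbound : ∀ B : Matrix (Fin 2) (Fin 2) ℝ, ∀ K : ℝ, ∃ K', ∀ v : Fin 2 → ℝ,
      (∀ i, |v i| ≤ K) → ∀ i, |(B *ᵥ v) i| ≤ K' := by
    intro B K
    refine ⟨(|B 0 0| + |B 0 1| + |B 1 0| + |B 1 1|) * K, fun v hv i => ?_⟩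
    have key : ∀ i, |(B *ᵥ v) i| ≤ |B i 0| * K + |B i 1| * K := fun i => by
      simp only [Matrix.mulVec, dotProduct, Fin.sum_univ_two]
      refine (abs_add_le _ _).trans ?_
      rw [abs_mul, abs_mul]
      gcongr <;> exact hv _
    have hK : 0 ≤ K := (abs_nonneg _).trans (hv 0)
    refine (key i).trans ?_
    rw [← add_mul]
    refine mul_le_mul_of_nonneg_right ?_ hK
    have := abs_nonneg (B 0 0)
    have := abs_nonneg (B 0 1)
    have := abs_nonneg (B 1 0)
    have := abs_nonneg (B 1 1)
    fin_cases i <;> simp <;> linarith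
  have hxb : ∀ t, ∃ K, ∀ p i, |(x p t - A ^ t *ᵥ p) i| ≤ K := by
    intro t
    induction t with
    | zero => exact ⟨0, fun p i => by simp [hx0]⟩
    | succ t ih =>
      obtain ⟨K, hK⟩ := ih
      obtain ⟨K', hK'⟩ := hbound A K
      refine ⟨K' + D, fun p i => ?_⟩
      have : x p (t + 1) - A ^ (t + 1) *ᵥ p
          = A *ᵥ (x p t - A ^ t *ᵥ p) + ![0, g t (x p t 0)] := by
        rw [hxs, Matrix.mulVec_sub, Matrix.mulVec_mulVec, ← pow_succ']
        abel
      rw [this]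
      refine (abs_add_le _ _).trans (add_le_add (hK' _ (hK p) i) ?_)
      have hD0 : 0 ≤ D := (abs_nonneg _).trans (hD 0 0)
      fin_cases i
      · simpa using hD0
      · simpa using hD t _
  obtain ⟨K, hK⟩ := hxb N
  obtain ⟨K', hK'⟩ := hbound (1 - A ^ N)⁻¹ K
  obtain ⟨p, hp⟩ := exists_fixedPoint_of_bounded_fin_two
    (f := fun p => (1 - A ^ N)⁻¹ *ᵥ (x p N - A ^ N *ᵥ p)) (R := K')
    (Continuous.matrix_mulVec continuous_const
      ((hxc N).sub (Continuous.matrix_mulVec continuous_const continuous_id)))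
    fun p i => hK' _ (hK p) i
  have hpN : x p N = p := by
    have := congrArg ((1 - A ^ N) *ᵥ ·) hp
    simp only [Matrix.mulVec_mulVec] at this
    rw [Matrix.mul_nonsing_inv _ (isUnit_iff_ne_zero.2 hdet), Matrix.one_mulVec, Matrix.sub_mulVec,
      Matrix.one_mulVec] at this
    exact sub_left_injective this
  have hxper : ∀ t, x p (t + N) = x p t := by
    intro t
    induction t with
    | zero => simpa [hx0] using hpN
    | succ t ih => rw [add_right_comm, hxs, hxs, ih, hper]
  have h0 : ∀ t, x p (t + 1) 0 = x p t 1 := fun t => by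
    rw [hxs]; simp [hA, dotProduct, Fin.sum_univ_two]
  refine ⟨fun t => x p t 0, fun t => congrFun (hxper t) 0, fun t => ?_⟩
  change x p (t + 1 + 1) 0 + b * x p (t + 1) 0 + c * x p t 0 = g t (x p t 0)
  rw [h0 (t + 1), h0 t, hxs]
  simp [hA, dotProduct, Fin.sum_univ_two]
  ring

/-- If `1` is an eigenvalue of the `N`-th power of a companion matrix, then the characteristic
polynomial has a complex root which is an `N`-th root of unity. -/
theorem exists_root_of_det_one_sub_pow_eq_zero {N : ℕ} (hN : 0 < N) {b c : ℝ}
    (hdet : (1 - (!![0, 1; -c, -b] : Matrix (Fin 2) (Fin 2) ℝ) ^ N).det = 0) :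
    ∃ l : ℂ, l ^ N = 1 ∧ l ^ 2 + b * l + c = 0 := by
  let B : Matrix (Fin 2) (Fin 2) ℂ := !![0, 1; -c, -b]
  have hB : (Complex.ofRealHom.mapMatrix (!![0, 1; -c, -b] : Matrix (Fin 2) (Fin 2) ℝ)) = B := by
    ext i j
    fin_cases i <;> fin_cases j <;> simp [B]
  have h1 : (1 - B ^ N).det = 0 := by
    have := congrArg Complex.ofRealHom hdet
    rwa [RingHom.map_det, map_sub, map_pow, map_one, hB, map_zero] at this
  have h2 : (1 : ℂ) ∈ spectrum ℂ (B ^ N) := by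
    rw [spectrum.mem_iff, map_one, Matrix.isUnit_iff_isUnit_det, h1]
    simp
  rw [spectrum.map_pow_of_pos _ hN] at h2
  obtain ⟨l, hl, hlN⟩ := h2
  refine ⟨l, hlN, ?_⟩
  rw [spectrum.mem_iff, Matrix.isUnit_iff_isUnit_det, isUnit_iff_ne_zero, not_not,
    Matrix.det_fin_two] at hl
  simp [B, Matrix.algebraMap_matrix_apply] at hl
  linear_combination hl

/-- Under the non-resonance condition excluding a two-dimensional kernel, for odd `N` the only
`N`-th root of unity which can be a root of `l ^ 2 + b * l + c` is `1`. -/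
theorem one_add_add_eq_zero_of_det_eq_zero {N : ℕ} (hNodd : Odd N) {b c : ℝ}
    (hbc : (∃ k : ℤ, (N : ℝ) * Real.arccos (-b / 2) = 2 * Real.pi * k) → (c ≠ 1 ∨ 2 ≤ |b|))
    (hdet : (1 - (!![0, 1; -c, -b] : Matrix (Fin 2) (Fin 2) ℝ) ^ N).det = 0) :
    1 + b + c = 0 := by
  obtain ⟨l, hlN, hl⟩ := exists_root_of_det_one_sub_pow_eq_zero hNodd.pos hdet
  have hnorm : l.re ^ 2 + l.im ^ 2 = 1 := by
    have h1 : ‖l‖ = 1 := Complex.norm_eq_one_of_pow_eq_one hlN hNodd.pos.ne'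
    have h2 := Complex.sq_norm l
    rw [h1, Complex.normSq_apply] at h2
    linarith
  have hre := congrArg Complex.re hl
  have him := congrArg Complex.im hl
  simp [pow_two] at hre him
  by_cases hl0 : l.im = 0
  · have hlr : l = (l.re : ℂ) := Complex.ext rfl (by simpa using hl0)
    have h1 : l.re ^ N = 1 := by
      rw [hlr] at hlN
      exact_mod_cast hlN
    have h2 : l.re = 1 := hNodd.strictMono_pow.injective (by simpa using h1)
    rw [hl0, h2] at hre
    linarith
  · exfalso
    have hb : b = -2 * l.re := by
      apply mul_right_cancel₀ hl0
      linarith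
    have hc : c = 1 := by
      rw [hb] at hre
      nlinarith
    have him2 : 0 < l.im ^ 2 := by positivity
    have hlt : |l.re| < 1 := by
      rw [← sq_lt_one_iff_abs_lt_one]
      linarith
    have hb2 : -b / 2 = l.re := by rw [hb]; ring
    have hexp : Complex.exp (Real.arccos l.re * Complex.I) ^ N = 1 := by
      have hcos := Real.cos_arccos (abs_lt.1 hlt).1.le (abs_lt.1 hlt).2.le
      have hsin : Real.sin (Real.arccos l.re) = |l.im| := by
        rw [Real.sin_arccos, ← Real.sqrt_sq_eq_abs]
        congr 1
        linarith
      rw [Complex.exp_mul_I, ← Complex.ofReal_cos, ← Complex.ofReal_sin, hcos, hsin]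
      rcases abs_cases l.im with ⟨h, -⟩ | ⟨h, -⟩
      · rw [h, Complex.re_add_im, hlN]
      · have : (l.re : ℂ) + ((|l.im| : ℝ) : ℂ) * Complex.I = (starRingEnd ℂ) l := by
          rw [h]
          exact Complex.ext (by simp) (by simp)
        rw [this, ← map_pow, hlN, map_one]
    rw [← Complex.exp_nat_mul, Complex.exp_eq_one_iff] at hexp
    obtain ⟨k, hk⟩ := hexp
    have hk' : (N : ℝ) * Real.arccos (-b / 2) = 2 * Real.pi * k := by
      have := congrArg Complex.im hk
      simp at this
      rw [hb2]
      linarith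
    rcases hbc ⟨k, hk'⟩ with h | h
    · exact h hc
    · rw [hb, abs_mul, abs_neg, abs_two] at h
      linarith

/-- If `1 - A ^ N` is invertible, the homogeneous equation has no nonzero `N`-periodic solution. -/
theorem homogeneous_periodic_eq_zero {N : ℕ} {b c : ℝ}
    (hdet : (1 - (!![0, 1; -c, -b] : Matrix (Fin 2) (Fin 2) ℝ) ^ N).det ≠ 0)
    {k : ℕ → ℝ} (hper : ∀ t, k (t + N) = k t)
    (hk : ∀ t, k (t + 2) + b * k (t + 1) + c * k t = 0) (t : ℕ) : k t = 0 := by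
  set A : Matrix (Fin 2) (Fin 2) ℝ := !![0, 1; -c, -b] with hA
  have hpow : ∀ t, ![k t, k (t + 1)] = A ^ t *ᵥ ![k 0, k 1] := by
    intro t
    induction t with
    | zero => simp
    | succ t ih =>
      rw [pow_succ', ← Matrix.mulVec_mulVec, ← ih]
      ext i
      fin_cases i
      · simp [hA]
      · simp [hA]
        linarith [hk t]
  have h0 : ![k 0, k 1] = 0 := by
    refine Matrix.eq_zero_of_mulVec_eq_zero hdet ?_
    rw [Matrix.sub_mulVec, Matrix.one_mulVec, ← hpow, add_comm N 1, hper 1]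
    have := hper 0
    rw [zero_add] at this
    rw [this, sub_self]
  have := congrFun (hpow t) 0
  rw [h0, Matrix.mulVec_zero] at this
  simpa using this

/-- If `1 + b + c = 0` and `N` is odd, the `N`-periodic homogeneous solutions are constant. -/
theorem homogeneous_periodic_eq_const {N : ℕ} (hNodd : Odd N) {b c : ℝ} (hbc : 1 + b + c = 0)
    {k : ℕ → ℝ} (hper : ∀ t, k (t + N) = k t)
    (hk : ∀ t, k (t + 2) + b * k (t + 1) + c * k t = 0) (t : ℕ) : k t = k 0 := by
  have hd : ∀ t, k (t + 1) - k t = c ^ t * (k 1 - k 0) := by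
    intro t
    induction t with
    | zero => simp
    | succ t ih =>
      rw [pow_succ']
      linear_combination hk t + c * ih - k (t + 1) * hbc
  have h0 : k 1 - k 0 = 0 := by
    by_contra hne
    have hN := hd N
    have h1 := hper 0
    rw [zero_add] at h1
    rw [add_comm N 1, hper 1, h1] at hN
    have hcN : c ^ N = 1 := mul_right_cancel₀ hne (by linarith)
    have hc1 : c = 1 := hNodd.strictMono_pow.injective (by simpa using hcN)
    have hlin : ∀ t : ℕ, k t = k 0 + t * (k 1 - k 0) := by
      intro t
      induction t with
      | zero => simp
      | succ t ih =>
        have := hd t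
        rw [hc1, one_pow] at this
        push_cast
        linarith
    have h2 := hlin N
    rw [h1] at h2
    have hN0 : (N : ℝ) ≠ 0 := by exact_mod_cast hNodd.pos.ne'
    exact mul_ne_zero hN0 hne (by linarith)
  induction t with
  | zero => rfl
  | succ t ih =>
    have := hd t
    rw [h0, mul_zero] at this
    linarith

theorem sum_range_succ_eq_of_periodic {N : ℕ} {y : ℕ → ℝ} (hper : ∀ t, y (t + N) = y t) :
    ∑ t ∈ Finset.range N, y (t + 1) = ∑ t ∈ Finset.range N, y t := by
  have h1 := Finset.sum_range_succ y N
  have h2 := Finset.sum_range_succ' y N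
  have h3 := hper 0
  rw [zero_add] at h3
  linarith

theorem exists_forall_abs_le_of_periodic {N : ℕ} (hN : 0 < N) {y : ℕ → ℝ}
    (hper : ∀ t, y (t + N) = y t) : ∃ s, ∀ t, |y t| ≤ |y s| := by
  obtain ⟨s, -, hs⟩ := (Finset.range N).exists_max_image (fun t => |y t|) ⟨0, by simpa using hN⟩
  refine ⟨s, fun t => ?_⟩
  rw [← Function.Periodic.map_mod_nat (f := y) hper t]
  exact hs _ (Finset.mem_range.2 (Nat.mod_lt t hN))

theorem supNorm_nonneg (x : ℕ → Fin 2 → ℝ) : 0 ≤ supNorm x :=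
  Real.iSup_nonneg fun _ => Real.sqrt_nonneg _

theorem abs_apply_zero_le_supNorm {N : ℕ} (hN : 0 < N) {x : ℕ → Fin 2 → ℝ}
    (hper : ∀ t, x (t + N) = x t) (t : ℕ) : |x t 0| ≤ supNorm x := by
  have hle : |x t 0| ≤ euclNorm2 (x t) := by
    rw [euclNorm2, ← Real.sqrt_sq_eq_abs]
    exact Real.sqrt_le_sqrt (by nlinarith [sq_nonneg (x t 1)])
  obtain ⟨s, hs⟩ := exists_forall_abs_le_of_periodic hN (y := fun t => euclNorm2 (x t))
    fun t => by simp only [hper]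
  refine hle.trans (le_ciSup (f := fun t => euclNorm2 (x t)) ⟨|euclNorm2 (x s)|, ?_⟩ t)
  rintro _ ⟨u, rfl⟩
  exact (le_abs_self _).trans (hs u)

/-- A forcing term in the range of `x ↦ x (· + 1) - A x` is orthogonal to the adjoint solutions. -/
theorem sum_adjoint_mulVec_eq_zero {N m : ℕ} {A : Matrix (Fin 2) (Fin 2) ℝ}
    (hdet : IsUnit A.det) {W : Matrix (Fin 2) (Fin m) ℝ} (hW : (1 - A ^ N)ᵀ * W = 0)
    {x : ℕ → Fin 2 → ℝ} (hper : ∀ t, x (t + N) = x t) :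
    ∑ i ∈ Finset.range N, (((A⁻¹) ^ i)ᵀ * (A ^ N)ᵀ * W)ᵀ *ᵥ (x (i + 1) - A *ᵥ x i) = 0 := by
  have hWA : Wᵀ * A ^ N = Wᵀ := by
    have := congrArg Matrix.transpose hW
    rw [Matrix.transpose_mul, Matrix.transpose_transpose, Matrix.mul_sub, Matrix.mul_one,
      Matrix.transpose_zero, sub_eq_zero] at this
    exact this.symm
  have hcomm : Commute A⁻¹ A := by
    rw [Commute, SemiconjBy, Matrix.nonsing_inv_mul _ hdet, Matrix.mul_nonsing_inv _ hdet]
  have hterm : ∀ i, (((A⁻¹) ^ i)ᵀ * (A ^ N)ᵀ * W)ᵀ *ᵥ (x (i + 1) - A *ᵥ x i)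
      = (Wᵀ * A * A⁻¹ ^ (i + 1)) *ᵥ x (i + 1) - (Wᵀ * A * A⁻¹ ^ i) *ᵥ x i := by
    intro i
    rw [Matrix.transpose_mul, Matrix.transpose_mul, Matrix.transpose_transpose,
      Matrix.transpose_transpose, ← Matrix.mul_assoc, hWA, Matrix.mulVec_sub,
      Matrix.mulVec_mulVec, Matrix.mul_assoc Wᵀ _ A, (hcomm.pow_left i).eq,
      Matrix.mul_assoc Wᵀ A (A⁻¹ ^ (i + 1)), pow_succ', ← Matrix.mul_assoc A,
      Matrix.mul_nonsing_inv _ hdet, Matrix.one_mul, Matrix.mul_assoc]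
  rw [Finset.sum_congr rfl fun i _ => hterm i,
    Finset.sum_range_sub (fun i => (Wᵀ * A * A⁻¹ ^ i) *ᵥ x i)]
  have hx := hper 0
  rw [zero_add] at hx
  have hinv : A ^ N * A⁻¹ ^ N = 1 := by
    rw [← hcomm.symm.mul_pow, Matrix.mul_nonsing_inv _ hdet, one_pow]
  have : Wᵀ * A * A⁻¹ ^ N = Wᵀ * A := by
    calc Wᵀ * A * A⁻¹ ^ N = Wᵀ * A ^ N * A * A⁻¹ ^ N := by rw [hWA]
      _ = Wᵀ * A * (A ^ N * A⁻¹ ^ N) := by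
        rw [Matrix.mul_assoc Wᵀ, (Commute.pow_self A N).eq]
        simp only [Matrix.mul_assoc]
      _ = Wᵀ * A := by rw [hinv, Matrix.mul_one]
  rw [hx, this]
  simp

/-- An `N`-periodic solution with forcing bounded by `D` is within `C * D` of a homogeneous one. -/
theorem exists_homogeneous_near {N : ℕ} (hN : 0 < N) {b c : ℝ}
    {A : Matrix (Fin 2) (Fin 2) ℝ} (hA : A = !![0, 1; -c, -b])
    {Q Mp : (ℕ → Fin 2 → ℝ) → ℕ → Fin 2 → ℝ}
    (hQ : ∀ x : ℕ → Fin 2 → ℝ, (∀ t, x (t + N) = x t) →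
      Q (fun t => x (t + 1) - A *ᵥ x t) = 0)
    (hMp : ∀ h : ℕ → Fin 2 → ℝ, (∀ t : ℕ, h (t + N) = h t) →
      (∃ x : ℕ → Fin 2 → ℝ, (∀ t : ℕ, x (t + N) = x t) ∧
        ∀ t : ℕ, x (t + 1) - A *ᵥ x t = h t) →
      (∀ t : ℕ, Mp h (t + N) = Mp h t) ∧ ∀ t : ℕ, Mp h (t + 1) - A *ᵥ Mp h t = h t)
    {C : ℝ} (hC0 : 0 ≤ C)
    (hC : ∀ h : ℕ → Fin 2 → ℝ, (∀ t : ℕ, h (t + N) = h t) →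
      supNorm (Mp (h - Q h)) ≤ C * supNorm h)
    {y η : ℕ → ℝ} (hy : ∀ t, y (t + N) = y t)
    (hη : ∀ t, y (t + 2) + b * y (t + 1) + c * y t = η t) {D : ℝ} (hD : ∀ t, |η t| ≤ D) :
    ∃ k : ℕ → ℝ, (∀ t, k (t + N) = k t) ∧
      (∀ t, k (t + 2) + b * k (t + 1) + c * k t = 0) ∧ ∀ t, |y t - k t| ≤ C * D := by
  let x : ℕ → Fin 2 → ℝ := fun t => ![y t, y (t + 1)]
  let h : ℕ → Fin 2 → ℝ := fun t => ![0, η t]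
  have hx : ∀ t, x (t + N) = x t := fun t => by
    simp only [x, add_right_comm t N 1, hy]
  have hxh : ∀ t, x (t + 1) - A *ᵥ x t = h t := fun t => by
    ext i
    fin_cases i
    · simp [x, h, hA]
    · simp [x, h, hA, ← hη t]
      ring
  have hh : ∀ t, h (t + N) = h t := fun t => by
    rw [← hxh, ← hxh, add_right_comm, hx, hx]
  have hQh : Q h = 0 := by
    rw [← hQ x hx, funext hxh]
  obtain ⟨hu, huh⟩ := hMp h hh ⟨x, hx, hxh⟩
  have hCh := hC h hh
  rw [hQh, sub_zero] at hCh
  have hhD : supNorm h ≤ D := ciSup_le fun t => by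
    simpa [euclNorm2, h, Real.sqrt_sq_eq_abs] using hD t
  have hu0 : ∀ t, Mp h (t + 1) 0 = Mp h t 1 := fun t => by
    have := congrFun (huh t) 0
    simp [h, hA, dotProduct, Fin.sum_univ_two] at this
    linarith
  have hu1 : ∀ t, Mp h (t + 2) 0 + b * Mp h (t + 1) 0 + c * Mp h t 0 = η t := fun t => by
    have := congrFun (huh t) 1
    simp [h, hA, dotProduct, Fin.sum_univ_two] at this
    rw [hu0 (t + 1), hu0 t]
    linarith
  refine ⟨fun t => y t - Mp h t 0, fun t => by simp only [hy, hu], fun t => ?_, fun t => ?_⟩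
  · linear_combination hη t - hu1 t
  · rw [sub_sub_cancel]
    exact (abs_apply_zero_le_supNorm hN hu t).trans
      (hCh.trans (mul_le_mul_of_nonneg_left hhD hC0))

/-- Arbitrarily small perturbations of `c` make `1 - A ^ N` invertible. -/
theorem exists_det_ne_zero_perturbation {N : ℕ} (hN : 0 < N) (b c : ℝ) {s : ℝ} (hs : 0 < s) :
    ∃ ε : ℝ, 0 < ε ∧ ε < s ∧
      (1 - (!![0, 1; -(c - ε), -b] : Matrix (Fin 2) (Fin 2) ℝ) ^ N).det ≠ 0 := by
  let S : Finset ℝ := (Polynomial.nthRoots N (1 : ℂ)).toFinset.image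
    fun l => (l ^ 2 + b * l + c).re
  obtain ⟨ε, hε, hεS⟩ := (Set.Ioo_infinite hs).exists_notMem_finset S
  refine ⟨ε, hε.1, hε.2, fun hdet => hεS ?_⟩
  obtain ⟨l, hlN, hl⟩ := exists_root_of_det_one_sub_pow_eq_zero hN hdet
  refine Finset.mem_image.2 ⟨l, by simpa [Polynomial.mem_nthRoots hN] using hlN, ?_⟩
  have : l ^ 2 + b * l + c = (ε : ℂ) := by
    push_cast at hl
    linear_combination hl
  rw [this, Complex.ofReal_re]

/-- If `1 + b + c = 0`, an `N`-periodic solution forced by a term having the sign of `y` outside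
`[-z, z]` cannot stay close to a constant of absolute value larger than `z`. -/
theorem abs_le_of_forall_abs_sub_le {N : ℕ} (hN : 0 < N) {b c : ℝ} (hbc : 1 + b + c = 0)
    {y η : ℕ → ℝ} (hy : ∀ t, y (t + N) = y t)
    (hη : ∀ t, y (t + 2) + b * y (t + 1) + c * y t = η t) {z : ℝ} (hz : 0 < z)
    (hsign : ∀ t, z < |y t| → 0 < y t * η t) {a U : ℝ} (ha : ∀ t, |y t - a| ≤ U) :
    |a| ≤ z + U := by
  have hsum : ∑ t ∈ Finset.range N, η t = 0 := by
    have h1 := sum_range_succ_eq_of_periodic hy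
    have h2 := sum_range_succ_eq_of_periodic (y := fun t => y (t + 1)) (N := N)
      fun t => by rw [add_right_comm, hy]
    simp only [← hη, Finset.sum_add_distrib, ← Finset.mul_sum]
    simp only [add_assoc, one_add_one_eq_two] at h2
    rw [h2, h1]
    linear_combination (∑ t ∈ Finset.range N, y t) * hbc
  have hne : (Finset.range N).Nonempty := ⟨0, by simpa using hN⟩
  by_contra! hlt
  rcases lt_abs.1 hlt with h | h
  · have hpos : ∀ t ∈ Finset.range N, 0 < η t := fun t _ => by
      have h1 : z < y t := by linarith [(abs_le.1 (ha t)).1]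
      exact pos_of_mul_pos_right (hsign t (h1.trans_le (le_abs_self _))) (hz.trans h1).le
    exact (Finset.sum_pos hpos hne).ne' hsum
  · have hneg : ∀ t ∈ Finset.range N, η t < 0 := fun t _ => by
      have h1 : y t < -z := by linarith [(abs_le.1 (ha t)).2]
      have h2 := hsign t (by linarith [neg_le_abs (y t)])
      nlinarith
    exact (Finset.sum_neg hneg hne).ne hsum

/-- The scalar form of the existence theorem, with the operator bound replaced by its consequence
for solutions of the forced equation. -/
theorem exists_periodic_solution_of_near_homogeneous {N : ℕ} (hNodd : Odd N) {b c : ℝ}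
    (hbc : (1 - (!![0, 1; -c, -b] : Matrix (Fin 2) (Fin 2) ℝ) ^ N).det = 0 → 1 + b + c = 0)
    {g : ℕ → ℝ → ℝ} (hg : ∀ t, Continuous (g t)) (hper : ∀ t x, g (t + N) x = g t x)
    {r z δ C : ℝ} (hz : 0 < z) (hδ : 0 < δ) (hC0 : 0 ≤ C)
    (hbound : ∀ (t : ℕ) (x : ℝ), x ∈ Set.Icc (-(2 * r)) (2 * r) → |g t x| ≤ δ)
    (hsign : ∀ (t : ℕ) (x : ℝ), z < |x| → 0 < x * g t x) (hr : z + C * δ < r)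
    (hnear : ∀ (y η : ℕ → ℝ) (D : ℝ), (∀ t, y (t + N) = y t) →
      (∀ t, y (t + 2) + b * y (t + 1) + c * y t = η t) → (∀ t, |η t| ≤ D) →
      ∃ k : ℕ → ℝ, (∀ t, k (t + N) = k t) ∧
        (∀ t, k (t + 2) + b * k (t + 1) + c * k t = 0) ∧ ∀ t, |y t - k t| ≤ C * D) :
    ∃ y : ℕ → ℝ, (∀ t, y (t + N) = y t) ∧
      ∀ t, y (t + 2) + b * y (t + 1) + c * y t = g t (y t) := by
  have hCδ : 0 ≤ C * δ := mul_nonneg hC0 hδ.le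
  let p : ℝ → ℝ := fun x => max (-(2 * r)) (min (2 * r) x)
  have hpc : Continuous p := by fun_prop
  have hpmem : ∀ x, p x ∈ Set.Icc (-(2 * r)) (2 * r) := fun x =>
    ⟨le_max_left _ _, max_le (by linarith) (min_le_left _ _)⟩
  have hpid : ∀ x, |x| ≤ 2 * r → p x = x := fun x hx => by
    simp only [p]
    rw [min_eq_right (abs_le.1 hx).2, max_eq_right (abs_le.1 hx).1]
  by_cases hdet : (1 - (!![0, 1; -c, -b] : Matrix (Fin 2) (Fin 2) ℝ) ^ N).det = 0
  · have hbc := hbc hdet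
    obtain ⟨ε, hε0, hε1, hεdet⟩ := exists_det_ne_zero_perturbation hNodd.pos b c
      (s := 1 / (2 * C + 1)) (by positivity)
    have hCε : 2 * C * ε ≤ 1 := by
      rw [lt_div_iff₀ (by positivity)] at hε1
      linarith
    obtain ⟨y, hy, hye⟩ := exists_periodic_solution_of_det_ne_zero hεdet
      (g := fun t x => g t (p x) - ε * p x) (D := δ + ε * (2 * r))
      (fun t => ((hg t).comp hpc).sub (continuous_const.mul hpc))
      (fun t x => by simp only [hper])
      fun t x => by
        refine (abs_sub _ _).trans (add_le_add (hbound t _ (hpmem x)) ?_)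
        rw [abs_mul, abs_of_pos hε0]
        exact mul_le_mul_of_nonneg_left (abs_le.2 (hpmem x)) hε0.le
    have hη : ∀ t, y (t + 2) + b * y (t + 1) + c * y t
        = g t (p (y t)) + ε * (y t - p (y t)) := fun t => by
      linear_combination hye t
    obtain ⟨s, hs⟩ := exists_forall_abs_le_of_periodic hNodd.pos hy
    obtain ⟨k, hk, hke, hyk⟩ := hnear y _ (δ + ε * max 0 (|y s| - 2 * r)) hy hη fun t => by
      refine (abs_add_le _ _).trans (add_le_add (hbound t _ (hpmem _)) ?_)
      rw [abs_mul, abs_of_pos hε0]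
      refine mul_le_mul_of_nonneg_left ?_ hε0.le
      by_cases hyt : |y t| ≤ 2 * r
      · rw [hpid _ hyt, sub_self, abs_zero]
        exact le_max_left _ _
      · refine le_max_of_le_right ((sub_le_sub_right (hs t) _).trans' ?_)
        rcases lt_abs.1 (not_le.1 hyt) with h | h
        · rw [show p (y t) = 2 * r by
            simp only [p]; rw [min_eq_left h.le, max_eq_right (by linarith)]]
          rw [abs_of_pos (by linarith)]
          linarith [le_abs_self (y t)]
        · rw [show p (y t) = -(2 * r) by
            simp only [p]; rw [min_eq_right (by linarith), max_eq_left (by linarith)]]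
          rw [abs_of_neg (by linarith)]
          linarith [neg_le_abs (y t)]
    have hk0 := fun t => homogeneous_periodic_eq_const hNodd hbc hk hke t
    simp only [hk0] at hyk
    have hα := abs_le_of_forall_abs_sub_le hNodd.pos hbc hy hη hz (fun t ht => by
      by_cases hyt : |y t| ≤ 2 * r
      · rw [hpid _ hyt, sub_self, mul_zero, add_zero]
        exact hsign t _ ht
      · rcases lt_abs.1 (not_le.1 hyt) with h | h
        · have hp : p (y t) = 2 * r := by
            simp only [p]; rw [min_eq_left h.le, max_eq_right (by linarith)]
          have h1 := hsign t (2 * r) (by rw [abs_of_pos] <;> linarith)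
          have h2 : 0 < g t (2 * r) := pos_of_mul_pos_right h1 (by linarith)
          rw [hp]
          have h3 : 0 < ε * (y t - 2 * r) := mul_pos hε0 (by linarith)
          exact mul_pos (by linarith) (by linarith)
        · have hp : p (y t) = -(2 * r) := by
            simp only [p]; rw [min_eq_right (by linarith), max_eq_left (by linarith)]
          have h1 := hsign t (-(2 * r)) (by rw [abs_neg, abs_of_pos] <;> linarith)
          have h2 : g t (-(2 * r)) < 0 := by nlinarith
          rw [hp]
          have h3 : ε * (y t - -(2 * r)) < 0 := mul_neg_of_pos_of_neg hε0 (by linarith)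
          exact mul_pos_of_neg_of_neg (by linarith) (by linarith)) hyk
    have hys : |y s| ≤ 2 * r := by
      by_contra! hlt
      have h1 : |y s| ≤ |y s - k 0| + |k 0| := by
        simpa using abs_add_le (y s - k 0) (k 0)
      have h2 := hyk s
      rw [max_eq_right (by linarith)] at h2 hα
      have h3 : 2 * C * ε * (|y s| - 2 * r) ≤ 1 * (|y s| - 2 * r) :=
        mul_le_mul_of_nonneg_right hCε (by linarith)
      nlinarith
    refine ⟨y, hy, fun t => ?_⟩
    rw [hη, hpid _ ((hs t).trans hys)]
    ring
  · obtain ⟨y, hy, hye⟩ := exists_periodic_solution_of_det_ne_zero hdet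
      (g := fun t x => g t (p x)) (D := δ) (fun t => (hg t).comp hpc)
      (fun t x => hper t _) fun t x => hbound t _ (hpmem x)
    obtain ⟨k, hk, hke, hyk⟩ := hnear y _ δ hy hye fun t => hbound t _ (hpmem _)
    refine ⟨y, hy, fun t => ?_⟩
    have h1 := hyk t
    rw [homogeneous_periodic_eq_zero hdet hk hke t, sub_zero] at h1
    rw [hye, hpid _ (by linarith)]

/-- Theorem 3.1: Let `N > 1` be odd, `c ≠ 0`, `g` continuous in `x` and
`N`-periodic in `t`, and `r, ẑ, δ > 0` with:
(C1) `|g(t,x)| ≤ δ` on `[−2r, 2r]`;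
(C2) `x·g(t,x) > 0` for `|x| > ẑ`;
(C3) `ẑ + ‖M_p(I − Q)‖·δ < r`;
(C4) if `N·arccos(−b/2)` is an integer multiple of `2π`, then `c ≠ 1` or `|b| ≥ 2`.
Then `y(t+2) + b y(t+1) + c y(t) = g(t, y(t))` has an `N`-periodic solution.

Here `A = [[0,1],[−c,−b]]`; `V` is the orthogonal projection of `ℝ²` onto
`Ker(I − A^N)` and `(Px)(t) = A^t V x(0)` (a projection onto `Ker 𝓛`); `W` is a matrix
whose columns form a basis of `Ker((I − A^N)ᵀ)`, `Ψ(t) = (A^{−t})ᵀ(A^N)ᵀW`,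
`G = Σ_{j<N} Ψ(j)ᵀΨ(j)`, and `(Qh)(t) = Ψ(t) G⁻¹ Σ_{i<N} Ψ(i)ᵀ h(i)` (a projection with
kernel `range 𝓛`); `M_p` is the inverse of `𝓛` restricted to `Ker P ∩ X_N → range 𝓛`,
and `C` is any bound for the operator norm of `h ↦ M_p((I − Q)h)` on `X_N`. -/
theorem periodic_solution_dim_lt_two
    (N : ℕ) (hN : 1 < N) (hNodd : Odd N) (b c : ℝ) (hc : c ≠ 0)
    (A : Matrix (Fin 2) (Fin 2) ℝ) (hA : A = !![0, 1; -c, -b])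
    (g : ℕ → ℝ → ℝ) (hgcont : ∀ t : ℕ, Continuous (g t))
    (hgper : ∀ (t : ℕ) (x : ℝ), g (t + N) x = g t x)
    (r z δ : ℝ) (hr : 0 < r) (hz : 0 < z) (hδ : 0 < δ)
    -- C1
    (hC1 : ∀ (t : ℕ) (x : ℝ), x ∈ Set.Icc (-(2 * r)) (2 * r) → |g t x| ≤ δ)
    -- C2
    (hC2 : ∀ (t : ℕ) (x : ℝ), z < |x| → 0 < x * g t x)
    -- C4
    (hC4 : (∃ k : ℤ, (N : ℝ) * Real.arccos (-b / 2) = 2 * Real.pi * k) →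
      (c ≠ 1 ∨ 2 ≤ |b|))
    -- the orthogonal projection V onto Ker(I − A^N) and the projection P
    (V : (Fin 2 → ℝ) →ₗ[ℝ] (Fin 2 → ℝ))
    (hV1 : ∀ u : Fin 2 → ℝ, (1 - A ^ N) *ᵥ V u = 0)
    (hV2 : ∀ u : Fin 2 → ℝ, (1 - A ^ N) *ᵥ u = 0 → V u = u)
    (hV3 : ∀ u w : Fin 2 → ℝ, (1 - A ^ N) *ᵥ w = 0 → (u - V u) ⬝ᵥ w = 0)
    (P : (ℕ → Fin 2 → ℝ) → (ℕ → Fin 2 → ℝ))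
    (hP : ∀ x : ℕ → Fin 2 → ℝ, P x = fun t => (A ^ t) *ᵥ V (x 0))
    -- the projection Q built from a basis matrix W of Ker((I − A^N)ᵀ)
    (m : ℕ) (W : Matrix (Fin 2) (Fin m) ℝ)
    (hWli : LinearIndependent ℝ (fun j : Fin m => Wᵀ j))
    (hWspan : Submodule.span ℝ (Set.range fun j : Fin m => Wᵀ j) =
      LinearMap.ker (((1 - A ^ N)ᵀ).mulVecLin))
    (Ψ : ℕ → Matrix (Fin 2) (Fin m) ℝ)
    (hΨ : ∀ t : ℕ, Ψ t = ((A⁻¹) ^ t)ᵀ * (A ^ N)ᵀ * W)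
    (G : Matrix (Fin m) (Fin m) ℝ)
    (hG : G = ∑ j ∈ Finset.range N, (Ψ j)ᵀ * Ψ j)
    (Q : (ℕ → Fin 2 → ℝ) → (ℕ → Fin 2 → ℝ))
    (hQ : ∀ h : ℕ → Fin 2 → ℝ,
      Q h = fun t => Ψ t *ᵥ (G⁻¹ *ᵥ ∑ i ∈ Finset.range N, (Ψ i)ᵀ *ᵥ h i))
    -- M_p : range 𝓛 → Ker P, the inverse of the restriction of 𝓛
    (Mp : (ℕ → Fin 2 → ℝ) → (ℕ → Fin 2 → ℝ))
    (hMp : ∀ h : ℕ → Fin 2 → ℝ, (∀ t : ℕ, h (t + N) = h t) →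
      (∃ x : ℕ → Fin 2 → ℝ, (∀ t : ℕ, x (t + N) = x t) ∧
        ∀ t : ℕ, x (t + 1) - A *ᵥ x t = h t) →
      (∀ t : ℕ, Mp h (t + N) = Mp h t) ∧ P (Mp h) = 0 ∧
        ∀ t : ℕ, Mp h (t + 1) - A *ᵥ Mp h t = h t)
    -- C is a bound for the operator norm ‖M_p ∘ (I − Q)‖ on X_N
    (C : ℝ)
    (hC : ∀ h : ℕ → Fin 2 → ℝ, (∀ t : ℕ, h (t + N) = h t) →
      supNorm (Mp (h - Q h)) ≤ C * supNorm h)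
    -- C3
    (hC3 : z + C * δ < r) :
    ∃ y : ℕ → ℝ, (∀ t : ℕ, y (t + N) = y t) ∧
      ∀ t : ℕ, y (t + 2) + b * y (t + 1) + c * y t = g t (y t) := by
  subst hA
  have hdetA : IsUnit (!![0, 1; -c, -b] : Matrix (Fin 2) (Fin 2) ℝ).det := by
    simpa [Matrix.det_fin_two] using hc
  have hW : (1 - (!![0, 1; -c, -b] : Matrix (Fin 2) (Fin 2) ℝ) ^ N)ᵀ * W = 0 := by
    ext i j
    have hj : Wᵀ j ∈ LinearMap.ker
        ((1 - (!![0, 1; -c, -b] : Matrix (Fin 2) (Fin 2) ℝ) ^ N)ᵀ).mulVecLin :=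
      hWspan ▸ Submodule.subset_span ⟨j, rfl⟩
    exact congrFun (LinearMap.mem_ker.1 hj) i
  have hC0 : 0 ≤ C := by
    have h1 := hC (fun _ => ![0, 1]) fun _ => rfl
    have h2 : supNorm (fun _ => ![0, 1]) = 1 := by simp [supNorm, euclNorm2]
    rw [h2, mul_one] at h1
    exact (supNorm_nonneg _).trans h1
  refine exists_periodic_solution_of_near_homogeneous hNodd
    (one_add_add_eq_zero_of_det_eq_zero hNodd hC4) hgcont hgper hz hδ hC0 hC1 hC2 hC3
    fun y η D hy hη hD => exists_homogeneous_near hNodd.pos rfl (Q := Q) (fun x hx => ?_)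
      (fun h hh hr => ⟨(hMp h hh hr).1, (hMp h hh hr).2.2⟩) hC0 hC hy hη hD
  rw [hQ]
  simp only [hΨ]
  rw [sum_adjoint_mulVec_eq_zero hdetA hW hx, Matrix.mulVec_zero]
  simp only [Matrix.mulVec_zero]
  rfl
end

section
/- Let N > 1 be an odd integer and b, c real constants with c ≠ 0, and let g : ℕ × ℝ → ℝ be continuous in its second variable and N-periodic in its first variable. Suppose: (i) g is sublinear, i.e., there exist constants M₁, M₂ ≥ 0 and β with 0 ≤ β < 1 such that |g(t,x)| ≤ M₁|x|^β + M₂ for all t ∈ ℕ and x ∈ ℝ; (ii) there exists ẑ > 0 such that x·g(t,x) > 0 for all t ∈ ℕ and all x with |x| > ẑ; (iii) if N·arccos(−b/2) is an integer multiple of 2π, then c ≠ 1 or |b| ≥ 2. Then there exists an N-periodic function y : ℕ → ℝ (y(t+N) = y(t) for all t) satisfying y(t+2) + b·y(t+1) + c·y(t) = g(t, y(t)) for all t ∈ ℕ. -/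
open Filter Topology

theorem exists_forall_abs_sub_lt_of_cos_pos {s : ℝ → ℝ} (hs : Continuous s) {α : ℝ}
    (h : ∀ t, 0 < Real.cos (s t - α)) :
    ∃ n : ℤ, ∀ t, |s t - α - 2 * Real.pi * n| < Real.pi / 2 := by
  have hpi := Real.pi_pos
  set m : ℤ := round ((s 0 - α) / (2 * Real.pi)) with hm
  have hne : ∀ t, s t - α - 2 * Real.pi * m ≠ Real.pi / 2 ∧
      s t - α - 2 * Real.pi * m ≠ -(Real.pi / 2) := by
    intro t
    have key : Real.cos (s t - α - 2 * Real.pi * m) = Real.cos (s t - α) := by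
      rw [mul_comm, Real.cos_sub_int_mul_two_pi]
    constructor <;> intro h0 <;> rw [h0] at key <;> have := h t <;> simp at key <;> linarith
  have hc : Continuous fun t => s t - α - 2 * Real.pi * m := by fun_prop
  have h0 : |s 0 - α - 2 * Real.pi * m| < Real.pi / 2 := by
    have hle : |s 0 - α - 2 * Real.pi * m| ≤ Real.pi := by
      have h1 := abs_sub_round ((s 0 - α) / (2 * Real.pi))
      rw [← hm] at h1
      have h2 : s 0 - α - 2 * Real.pi * m = 2 * Real.pi * ((s 0 - α) / (2 * Real.pi) - m) := by
        field_simp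
      rw [h2, abs_mul, abs_of_pos (by positivity)]
      nlinarith
    by_contra! hge
    have key : Real.cos (s 0 - α - 2 * Real.pi * m) = Real.cos (s 0 - α) := by
      rw [mul_comm, Real.cos_sub_int_mul_two_pi]
    rw [← Real.cos_abs] at key
    have := Real.cos_nonpos_of_pi_div_two_le_of_le hge (by linarith)
    linarith [h 0]
  rw [abs_lt] at h0
  refine ⟨m, fun t => abs_lt.2 ⟨?_, ?_⟩⟩
  · by_contra! hle
    obtain ⟨u, hu⟩ := mem_range_of_exists_le_of_exists_ge hc ⟨t, hle⟩ ⟨0, h0.1.le⟩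
    exact (hne u).2 hu
  · by_contra! hle
    obtain ⟨u, hu⟩ := mem_range_of_exists_le_of_exists_ge hc ⟨0, h0.2.le⟩ ⟨t, hle⟩
    exact (hne u).1 hu

/-- The two-dimensional Poincaré–Miranda theorem. -/
theorem exists_common_zero_of_sign_on_square {R : ℝ} (hR : 0 < R) {f g : ℝ × ℝ → ℝ}
    (hf : Continuous f) (hg : Continuous g)
    (hright : ∀ y, |y| ≤ R → 0 < f (R, y)) (hleft : ∀ y, |y| ≤ R → f (-R, y) < 0)
    (htop : ∀ x, |x| ≤ R → 0 < g (x, R)) (hbot : ∀ x, |x| ≤ R → g (x, -R) < 0) :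
    ∃ v, f v = 0 ∧ g v = 0 := by
  by_contra! hne
  have hpi := Real.pi_pos
  let κ : ℝ → ℝ := fun x => max (-R) (min R x)
  have hκ : Continuous κ := by fun_prop
  have hκ_abs : ∀ x, |κ x| ≤ R := fun x =>
    abs_le.2 ⟨le_max_left _ _, max_le (by linarith) (min_le_left _ _)⟩
  have hκ_R : κ R = R := by simp [κ, hR.le]
  have hκ_neg : κ (-R) = -R := by simp [κ, hR.le]
  let F : ℝ × ℝ → ℂ := fun v => ⟨f (κ v.1, κ v.2), g (κ v.1, κ v.2)⟩
  have hF : Continuous F := by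
    have : F = fun v => (f (κ v.1, κ v.2) : ℂ) + (g (κ v.1, κ v.2) : ℂ) * Complex.I := by
      ext v; exact Complex.mk_eq_add_mul_I _ _
    rw [this]
    fun_prop
  obtain ⟨G, hG, hGF⟩ := Complex.exists_continuousOn_eqOn_exp_comp (U := Set.univ) (g := F)
    (Homeomorph.Set.univ (ℝ × ℝ)).toHomotopyEquiv.simplyConnectedSpace isOpen_univ hF.continuousOn (by
      rintro ⟨v, -, hv⟩
      exact hne _ (congrArg Complex.re hv) (congrArg Complex.im hv))
  rw [continuousOn_univ] at hG
  have hcos : ∀ v, f (κ v.1, κ v.2) = Real.exp (G v).re * Real.cos (G v).im := fun v => by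
    rw [← Complex.exp_re]; exact (congrArg Complex.re (hGF (Set.mem_univ v))).symm
  have hsin : ∀ v, g (κ v.1, κ v.2) = Real.exp (G v).re * Real.sin (G v).im := fun v => by
    rw [← Complex.exp_im]; exact (congrArg Complex.im (hGF (Set.mem_univ v))).symm
  have hθ : Continuous fun v => (G v).im := by fun_prop
  obtain ⟨n₁, h₁⟩ := exists_forall_abs_sub_lt_of_cos_pos (s := fun y => (G (R, y)).im) (α := 0)
    (by fun_prop) fun y => by
      have := hright _ (hκ_abs y)
      have h2 := hcos (R, y)
      simp only [hκ_R] at h2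
      rw [h2] at this
      simpa using pos_of_mul_pos_right this (Real.exp_pos _).le
  obtain ⟨n₂, h₂⟩ := exists_forall_abs_sub_lt_of_cos_pos (s := fun x => (G (x, R)).im)
    (α := Real.pi / 2) (by fun_prop) fun x => by
      have := htop _ (hκ_abs x)
      have h2 := hsin (x, R)
      simp only [hκ_R] at h2
      rw [h2] at this
      rw [Real.cos_sub_pi_div_two]
      exact pos_of_mul_pos_right this (Real.exp_pos _).le
  obtain ⟨n₃, h₃⟩ := exists_forall_abs_sub_lt_of_cos_pos (s := fun y => (G (-R, y)).im)
    (α := Real.pi) (by fun_prop) fun y => by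
      have := hleft _ (hκ_abs y)
      have h2 := hcos (-R, y)
      simp only [hκ_neg] at h2
      rw [h2] at this
      rw [Real.cos_sub_pi]
      exact pos_of_mul_pos_right (by linarith) (Real.exp_pos (G (-R, y)).re).le
  obtain ⟨n₄, h₄⟩ := exists_forall_abs_sub_lt_of_cos_pos (s := fun x => (G (x, -R)).im)
    (α := Real.pi / 2 + Real.pi) (by fun_prop) fun x => by
      have := hbot _ (hκ_abs x)
      have h2 := hsin (x, -R)
      simp only [hκ_neg] at h2
      rw [h2] at this
      rw [← sub_sub, Real.cos_sub_pi, Real.cos_sub_pi_div_two]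
      exact pos_of_mul_pos_right (by linarith) (Real.exp_pos (G (x, -R)).re).le
  have h1R := abs_lt.1 (h₁ R)
  have h2R := abs_lt.1 (h₂ R)
  have h2L := abs_lt.1 (h₂ (-R))
  have h3R := abs_lt.1 (h₃ R)
  have h3L := abs_lt.1 (h₃ (-R))
  have h4L := abs_lt.1 (h₄ (-R))
  have h4R := abs_lt.1 (h₄ R)
  have h1L := abs_lt.1 (h₁ (-R))
  have lt_of : ∀ {a b : ℤ}, Real.pi * a < Real.pi * b → a < b := fun h => by
    exact_mod_cast lt_of_mul_lt_mul_left h hpi.le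
  have e1 : 4 * n₁ < 4 * n₂ + 3 := lt_of (by push_cast; linarith)
  have e2 : 4 * n₂ < 4 * n₃ + 3 := lt_of (by push_cast; linarith)
  have e3 : 4 * n₃ < 4 * n₄ + 3 := lt_of (by push_cast; linarith)
  have e4 : 4 * n₄ + 1 < 4 * n₁ := lt_of (by push_cast; linarith)
  omega

theorem pow_ne_one_of_quadratic_root {N : ℕ} (hN : Odd N) {b c : ℝ}
    (hbc : 1 + b + c ≠ 0)
    (hres : (∃ k : ℤ, (N : ℝ) * Real.arccos (-b / 2) = 2 * Real.pi * k) → (c ≠ 1 ∨ 2 ≤ |b|))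
    {ω : ℂ} (hω : ω ^ 2 + b * ω + c = 0) : ω ^ N ≠ 1 := by
  intro hωN
  have hnorm : ‖ω‖ = 1 := Complex.norm_eq_one_of_pow_eq_one hωN hN.pos.ne'
  have hsq : ω.re ^ 2 + ω.im ^ 2 = 1 := by
    have := Complex.sq_norm ω
    rw [hnorm, Complex.normSq_apply] at this
    linarith
  have hre := congrArg Complex.re hω
  have him := congrArg Complex.im hω
  simp [pow_two] at hre him
  by_cases h0 : ω.im = 0
  · have hreal : ω = (ω.re : ℂ) := Complex.ext rfl (by simpa using h0)
    have h1 : ω.re ^ N = 1 := by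
      rw [hreal] at hωN
      exact_mod_cast hωN
    have h2 : ω.re = 1 := hN.strictMono_pow.injective (by simpa using h1)
    simp [h0, h2] at hre
    exact hbc hre
  · have hb : b = -2 * ω.re := by
      have : ω.im * (b + 2 * ω.re) = 0 := by linarith
      rcases mul_eq_zero.1 this with h | h
      · exact absurd h h0
      · linarith
    have hc1 : c = 1 := by subst hb; nlinarith
    have him2 : 0 < ω.im ^ 2 := by positivity
    have hbabs : |b| < 2 := by
      rw [hb]
      exact abs_lt_of_sq_lt_sq (by nlinarith) (by norm_num)
    have harccos : Real.arccos (-b / 2) = |Complex.arg ω| := by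
      have h1 : -b / 2 = Real.cos |Complex.arg ω| := by
        rw [Real.cos_abs, Complex.cos_arg (by rintro rfl; simp at hnorm), hnorm, hb]
        ring
      rw [h1, Real.arccos_cos (abs_nonneg _) (Complex.abs_arg_le_pi _)]
    have hexp : Complex.exp (N * (Complex.arg ω * Complex.I)) = 1 := by
      rw [Complex.exp_nat_mul, ← hωN]
      congr 1
      have := Complex.norm_mul_exp_arg_mul_I ω
      simpa [hnorm] using this
    obtain ⟨k, hk⟩ := Complex.exp_eq_one_iff.1 hexp
    have hk' : (N : ℝ) * Complex.arg ω = 2 * Real.pi * k := by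
      have := congrArg Complex.im hk
      simp at this
      linarith
    have : ∃ k : ℤ, (N : ℝ) * Real.arccos (-b / 2) = 2 * Real.pi * k := by
      rw [harccos]
      rcases abs_choice (Complex.arg ω) with h | h <;> rw [h]
      · exact ⟨k, hk'⟩
      · exact ⟨-k, by push_cast; linarith⟩
    rcases hres this with h | h
    · exact h hc1
    · linarith

theorem homogeneous_eq_zero {N : ℕ} {b c : ℝ}
    (hroot : ∀ ω : ℂ, ω ^ 2 + b * ω + c = 0 → ω ^ N ≠ 1) {y : ℕ → ℝ}
    (hy : ∀ t, y (t + 2) + b * y (t + 1) + c * y t = 0)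
    (h0 : y N = y 0) (h1 : y (N + 1) = y 1) : y 0 = 0 ∧ y 1 = 0 := by
  obtain ⟨s, hs⟩ := IsAlgClosed.exists_pow_nat_eq ((b : ℂ) ^ 2 - 4 * c) (n := 2) (by norm_num)
  set r : ℂ := (-b + s) / 2 with hr
  set q : ℂ := (-b - s) / 2 with hq
  have hrq : r + q = -b := by rw [hr, hq]; ring
  have hrq' : r * q = c := by rw [hr, hq]; linear_combination -hs / 4
  have hyC : ∀ t, (y (t + 2) : ℂ) + b * y (t + 1) + c * y t = 0 := fun t => by
    exact_mod_cast hy t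
  have hz : ∀ t, (y (t + 1) : ℂ) - r * y t = q ^ t * (y 1 - r * y 0) := by
    intro t
    induction t with
    | zero => simp
    | succ t ih =>
      rw [pow_succ']
      linear_combination hyC t + q * ih - (y (t + 1) : ℂ) * hrq + y t * hrq'
  have hz0 : (y 1 : ℂ) - r * y 0 = 0 := by
    by_contra hne
    refine hroot q (by linear_combination q * hrq - hrq') ?_
    have := hz N
    rw [h0, h1] at this
    exact mul_right_cancel₀ hne (by rw [← this, one_mul])
  have hyr : ∀ t, (y t : ℂ) = r ^ t * y 0 := by
    intro t
    induction t with
    | zero => simp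
    | succ t ih =>
      have := hz t
      rw [hz0] at this
      rw [pow_succ']
      linear_combination this + r * ih
  have hy0 : (y 0 : ℂ) = 0 := by
    by_contra hne
    refine hroot r (by linear_combination r * hrq - hrq') ?_
    have := hyr N
    rw [h0] at this
    exact mul_right_cancel₀ hne (by rw [← this, one_mul])
  rw [hy0] at hz0
  exact ⟨by exact_mod_cast hy0, by simpa using hz0⟩

/-- `h v = o(‖v‖)` at infinity, uniformly on balls: for every `ε > 0`, the function `h` is bounded
by `ε * R` on the ball of radius `R` for all large `R`. -/
def SublinearGrowth {E : Type*} [Norm E] (h : E → ℝ) : Prop :=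
  ∀ ε > 0, ∀ᶠ R : ℝ in atTop, ∀ v, ‖v‖ ≤ R → |h v| ≤ ε * R

namespace SublinearGrowth

theorem add {E : Type*} [Norm E] {h k : E → ℝ} (hh : SublinearGrowth h) (hk : SublinearGrowth k) :
    SublinearGrowth fun v => h v + k v := by
  intro ε hε
  filter_upwards [hh (ε / 2) (by positivity), hk (ε / 2) (by positivity)] with R h1 h2 v hv
  linarith [abs_add_le (h v) (k v), h1 v hv, h2 v hv]

theorem const_mul {E : Type*} [Norm E] {h : E → ℝ} (hh : SublinearGrowth h) (a : ℝ) :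
    SublinearGrowth fun v => a * h v := by
  intro ε hε
  filter_upwards [hh (ε / (|a| + 1)) (by positivity)] with R h1 v hv
  have h2 := h1 v hv
  rw [abs_mul]
  calc |a| * |h v| ≤ (|a| + 1) * |h v| := by gcongr; linarith
    _ ≤ (|a| + 1) * (ε / (|a| + 1) * R) := by gcongr
    _ = ε * R := by field_simp

theorem comp {E F : Type*} [Norm E] [Norm F] {h : F → ℝ} (hh : SublinearGrowth h) {k : E → F}
    {K : ℝ} (hK : 0 < K) (hk : ∀ᶠ R : ℝ in atTop, ∀ v, ‖v‖ ≤ R → ‖k v‖ ≤ K * R) :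
    SublinearGrowth fun v => h (k v) := by
  intro ε hε
  have hlim : Tendsto (fun R : ℝ => K * R) atTop atTop := tendsto_id.const_mul_atTop hK
  filter_upwards [hk, hlim.eventually (hh (ε / K) (by positivity))] with R h1 h2 v hv
  calc |h (k v)| ≤ ε / K * (K * R) := h2 _ (h1 v hv)
    _ = ε * R := by field_simp

theorem comp_continuousLinearMap {E F : Type*} [NormedAddCommGroup E] [NormedSpace ℝ E]
    [NormedAddCommGroup F] [NormedSpace ℝ F] {h : F → ℝ} (hh : SublinearGrowth h) (T : E →L[ℝ] F) :
    SublinearGrowth fun v => h (T v) := by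
  refine hh.comp (K := ‖T‖ + 1) (by positivity) (Eventually.of_forall fun R v hv => ?_)
  calc ‖T v‖ ≤ ‖T‖ * ‖v‖ := T.le_opNorm v
    _ ≤ (‖T‖ + 1) * R := by gcongr; linarith

theorem comp_add {E : Type*} [NormedAddCommGroup E] [NormedSpace ℝ E] {f : ℝ → ℝ}
    (hf : SublinearGrowth f) {u : E → ℝ} (hu : SublinearGrowth u) (L : E →L[ℝ] ℝ) :
    SublinearGrowth fun v => f (L v + u v) := by
  refine hf.comp (K := ‖L‖ + 1) (by positivity) ?_
  filter_upwards [hu 1 one_pos] with R hR v hv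
  calc ‖L v + u v‖ ≤ ‖L v‖ + ‖u v‖ := norm_add_le _ _
    _ ≤ ‖L‖ * R + 1 * R := add_le_add (L.le_opNorm_of_le hv) (hR v hv)
    _ = (‖L‖ + 1) * R := by ring

theorem of_le_rpow {f : ℝ → ℝ} {M₁ M₂ β : ℝ} (hM₁ : 0 ≤ M₁) (hβ0 : 0 ≤ β) (hβ1 : β < 1)
    (hf : ∀ x, |f x| ≤ M₁ * |x| ^ β + M₂) : SublinearGrowth f := by
  intro ε hε
  have h1 : Tendsto (fun R : ℝ => M₁ * R ^ (-(1 - β)) + M₂ * R⁻¹) atTop (𝓝 0) := by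
    simpa using ((tendsto_rpow_neg_atTop (sub_pos.2 hβ1)).const_mul M₁).add
      (tendsto_inv_atTop_zero.const_mul M₂)
  filter_upwards [h1.eventually (gt_mem_nhds hε), eventually_gt_atTop 0] with R hR hR0 x hx
  have hxR : |x| ^ β ≤ R ^ β := Real.rpow_le_rpow (abs_nonneg x) hx hβ0
  have hpow : R ^ (-(1 - β)) * R = R ^ β := by
    rw [← Real.rpow_add_one hR0.ne']
    congr 1
    ring
  calc |f x| ≤ M₁ * R ^ β + M₂ := (hf x).trans (by gcongr)
    _ = (M₁ * R ^ (-(1 - β)) + M₂ * R⁻¹) * R := by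
      rw [← hpow]
      field_simp
    _ ≤ ε * R := by gcongr

end SublinearGrowth

/-- The solution of `y (t + 2) + b * y (t + 1) + c * y t = g t (y t)` with initial data
`(y 0, y 1) = v`. -/
def solution (b c : ℝ) (g : ℕ → ℝ → ℝ) (v : ℝ × ℝ) : ℕ → ℝ
  | 0 => v.1
  | 1 => v.2
  | t + 2 => g t (solution b c g v t) - b * solution b c g v (t + 1) - c * solution b c g v t

/-- The solution of `y (t + 2) + b * y (t + 1) + c * y t = 0` at time `t`, as a linear function of
the initial data `(y 0, y 1)`. -/
noncomputable def linearSolution (b c : ℝ) : ℕ → (ℝ × ℝ →L[ℝ] ℝ)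
  | 0 => ContinuousLinearMap.fst ℝ ℝ ℝ
  | 1 => ContinuousLinearMap.snd ℝ ℝ ℝ
  | t + 2 => -(b • linearSolution b c (t + 1)) - c • linearSolution b c t

theorem solution_recurrence (b c : ℝ) (g : ℕ → ℝ → ℝ) (v : ℝ × ℝ) (t : ℕ) :
    solution b c g v (t + 2) + b * solution b c g v (t + 1) + c * solution b c g v t =
      g t (solution b c g v t) := by
  rw [solution]
  ring

theorem linearSolution_recurrence (b c : ℝ) (v : ℝ × ℝ) (t : ℕ) :
    linearSolution b c (t + 2) v + b * linearSolution b c (t + 1) v + c * linearSolution b c t v =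
      0 := by
  rw [linearSolution]
  simp
  ring

theorem continuous_solution {b c : ℝ} {g : ℕ → ℝ → ℝ} (hg : ∀ t, Continuous (g t)) (t : ℕ) :
    Continuous fun v => solution b c g v t := by
  induction t using Nat.twoStepInduction with
  | zero => exact continuous_fst
  | one => exact continuous_snd
  | more t h0 h1 =>
    simp only [solution]
    exact (((hg t).comp h0).sub (h1.const_mul b)).sub (h0.const_mul c)

theorem solution_periodic {N : ℕ} {b c : ℝ} {g : ℕ → ℝ → ℝ} (hg : ∀ t x, g (t + N) x = g t x)
    {v : ℝ × ℝ} (h0 : solution b c g v N = v.1) (h1 : solution b c g v (N + 1) = v.2) (t : ℕ) :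
    solution b c g v (t + N) = solution b c g v t := by
  induction t using Nat.twoStepInduction with
  | zero => rw [zero_add, h0, solution]
  | one => rw [add_comm, h1, solution]
  | more t ih0 ih1 =>
    have e1 := solution_recurrence b c g v (t + N)
    have e0 := solution_recurrence b c g v t
    rw [show t + N + 2 = t + 2 + N by ring, show t + N + 1 = t + 1 + N by ring, ih0, ih1, hg] at e1
    linarith

theorem sublinearGrowth_solution_sub {b c : ℝ} {g : ℕ → ℝ → ℝ}
    (hg : ∀ t, SublinearGrowth (g t)) (t : ℕ) :
    SublinearGrowth fun v => solution b c g v t - linearSolution b c t v := by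
  have hzero : SublinearGrowth fun _ : ℝ × ℝ => (0 : ℝ) := by
    intro ε hε
    filter_upwards [eventually_ge_atTop 0] with R hR v _
    simpa using by positivity
  induction t using Nat.twoStepInduction with
  | zero => simpa [solution, linearSolution] using hzero
  | one => simpa [solution, linearSolution] using hzero
  | more t h0 h1 =>
    convert! (((hg t).comp_add h0 (linearSolution b c t)).add (h1.const_mul (-b))).add
      (h0.const_mul (-c)) using 2 with v
    have e1 := solution_recurrence b c g v t
    have e0 := linearSolution_recurrence b c v t
    rw [add_sub_cancel]
    linarith

/-- A sublinear continuous perturbation of a linear automorphism of the plane has a zero. -/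
theorem exists_zero_of_linearEquiv_add_sublinear (Q : (ℝ × ℝ) ≃L[ℝ] (ℝ × ℝ)) {h k : ℝ × ℝ → ℝ}
    (hh : SublinearGrowth h) (hk : SublinearGrowth k) (hhc : Continuous h) (hkc : Continuous k) :
    ∃ v, (Q v).1 + h v = 0 ∧ (Q v).2 + k v = 0 := by
  have hh' := hh.comp_continuousLinearMap (Q.symm : (ℝ × ℝ) →L[ℝ] (ℝ × ℝ))
  have hk' := hk.comp_continuousLinearMap (Q.symm : (ℝ × ℝ) →L[ℝ] (ℝ × ℝ))
  obtain ⟨R, h1, h2, hR⟩ := ((hh' (1 / 2) (by norm_num)).and ((hk' (1 / 2) (by norm_num)).and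
    (eventually_gt_atTop 0))).exists
  simp only [Prod.norm_def, sup_le_iff, Real.norm_eq_abs, ContinuousLinearEquiv.coe_coe] at h1 h2
  have hRR : |R| ≤ R := (abs_of_pos hR).le
  have hRR' : |-R| ≤ R := by rwa [abs_neg]
  obtain ⟨w, hw1, hw2⟩ := exists_common_zero_of_sign_on_square hR
    (f := fun w => w.1 + h (Q.symm w)) (g := fun w => w.2 + k (Q.symm w))
    (by fun_prop) (by fun_prop)
    (fun y hy => by linarith [(abs_le.1 (h1 (R, y) ⟨hRR, hy⟩)).1])
    (fun y hy => by linarith [(abs_le.1 (h1 (-R, y) ⟨hRR', hy⟩)).2])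
    (fun x hx => by linarith [(abs_le.1 (h2 (x, R) ⟨hx, hRR⟩)).1])
    (fun x hx => by linarith [(abs_le.1 (h2 (x, -R) ⟨hx, hRR'⟩)).2])
  exact ⟨Q.symm w, by simpa using hw1, by simpa using hw2⟩

theorem exists_periodic_initial_data_of_nonresonant {N : ℕ} {b c : ℝ} {g : ℕ → ℝ → ℝ}
    (hroot : ∀ ω : ℂ, ω ^ 2 + b * ω + c = 0 → ω ^ N ≠ 1)
    (hgc : ∀ t, Continuous (g t)) (hg : ∀ t, SublinearGrowth (g t)) :
    ∃ v, solution b c g v N = v.1 ∧ solution b c g v (N + 1) = v.2 := by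
  let A : (ℝ × ℝ) →L[ℝ] (ℝ × ℝ) :=
    (linearSolution b c N).prod (linearSolution b c (N + 1)) - ContinuousLinearMap.id ℝ (ℝ × ℝ)
  have hA : Function.Injective (A : (ℝ × ℝ) →ₗ[ℝ] (ℝ × ℝ)) := by
    refine (injective_iff_map_eq_zero _).2 fun v hv => ?_
    have h1 : linearSolution b c N v = v.1 := by simpa [A, sub_eq_zero] using congrArg Prod.fst hv
    have h2 : linearSolution b c (N + 1) v = v.2 := by
      simpa [A, sub_eq_zero] using congrArg Prod.snd hv
    obtain ⟨e0, e1⟩ := homogeneous_eq_zero hroot (y := fun t => linearSolution b c t v)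
      (linearSolution_recurrence b c v) h1 h2
    exact Prod.ext e0 e1
  let Q : (ℝ × ℝ) ≃L[ℝ] (ℝ × ℝ) := (LinearEquiv.ofInjectiveEndo _ hA).toContinuousLinearEquiv
  have hQ : ∀ v, Q v = A v := fun v => rfl
  have hc := continuous_solution (b := b) (c := c) hgc
  obtain ⟨v, h1, h2⟩ := exists_zero_of_linearEquiv_add_sublinear Q
    (sublinearGrowth_solution_sub (b := b) (c := c) hg N)
    (sublinearGrowth_solution_sub (b := b) (c := c) hg (N + 1))
    ((hc N).sub (by fun_prop)) ((hc (N + 1)).sub (by fun_prop))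
  refine ⟨v, ?_, ?_⟩
  · simp [hQ, A] at h1
    linarith
  · simp [hQ, A] at h2
    linarith

theorem linearSolution_of_resonant {b c : ℝ} (hbc : 1 + b + c = 0) (p d : ℝ) (t : ℕ) :
    linearSolution b c t (p, p + d) = p + d * ∑ i ∈ Finset.range t, c ^ i := by
  induction t using Nat.twoStepInduction with
  | zero => simp [linearSolution]
  | one => simp [linearSolution]
  | more t h0 h1 =>
    have e := linearSolution_recurrence b c (p, p + d) t
    rw [h0, h1, Finset.sum_range_succ] at e
    rw [Finset.sum_range_succ, Finset.sum_range_succ]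
    have hb : b = -1 - c := by linarith
    subst hb
    rw [pow_succ]
    linear_combination e

theorem sum_range_solution_of_resonant {b c : ℝ} (hbc : 1 + b + c = 0) (g : ℕ → ℝ → ℝ) (v : ℝ × ℝ)
    (n : ℕ) :
    ∑ t ∈ Finset.range n, g t (solution b c g v t) =
      solution b c g v (n + 1) - v.2 - c * (solution b c g v n - v.1) := by
  induction n with
  | zero => simp [solution]
  | succ n ih =>
    rw [Finset.sum_range_succ, ih, ← solution_recurrence b c g v n]
    linear_combination solution b c g v (n + 1) * hbc

theorem geom_sum_ne_zero_of_odd {N : ℕ} (hN : Odd N) (c : ℝ) :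
    ∑ i ∈ Finset.range N, c ^ i ≠ 0 := by
  intro h
  have h1 := mul_geom_sum c N
  rw [h, mul_zero] at h1
  have hc : c = 1 := hN.strictMono_pow.injective (by simpa using by linarith)
  rw [hc] at h
  simp at h
  exact hN.pos.ne' h

theorem exists_periodic_initial_data_of_resonant {N : ℕ} (hN : Odd N) {b c : ℝ}
    (hbc : 1 + b + c = 0) {g : ℕ → ℝ → ℝ} (hgc : ∀ t, Continuous (g t))
    (hg : ∀ t, SublinearGrowth (g t)) {z : ℝ} (hsign : ∀ t x, z < |x| → 0 < x * g t x) :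
    ∃ v, solution b c g v N = v.1 ∧ solution b c g v (N + 1) = v.2 := by
  set κ : ℕ → ℝ := fun t => ∑ i ∈ Finset.range t, c ^ i with hκ
  have hκN : κ N ≠ 0 := geom_sum_ne_zero_of_odd hN c
  obtain ⟨δ, hδ, hδκ⟩ : ∃ δ : ℝ, 0 < δ ∧ ∀ t ∈ Finset.range N, δ * |κ t| ≤ 1 / 2 := by
    have hS : 0 ≤ ∑ t ∈ Finset.range N, |κ t| := Finset.sum_nonneg fun _ _ => abs_nonneg _
    refine ⟨1 / (2 * (1 + ∑ t ∈ Finset.range N, |κ t|)), by positivity, fun t ht => ?_⟩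
    have := Finset.single_le_sum (f := fun t => |κ t|) (fun _ _ => abs_nonneg _) ht
    rw [div_mul_eq_mul_div, div_le_div_iff₀ (by positivity) (by norm_num)]
    linarith
  let T : (ℝ × ℝ) →L[ℝ] (ℝ × ℝ) := (ContinuousLinearMap.fst ℝ ℝ ℝ).prod
    (ContinuousLinearMap.fst ℝ ℝ ℝ + δ • ContinuousLinearMap.snd ℝ ℝ ℝ)
  have hT : ∀ p e, T (p, e) = (p, p + δ * e) := fun p e => by simp [T]
  let y : ℕ → ℝ × ℝ → ℝ := fun t w => solution b c g (T w) t
  have hyc : ∀ t, Continuous (y t) := fun t => (continuous_solution hgc t).comp T.continuous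
  let u : ℕ → ℝ × ℝ → ℝ := fun t w => y t w - linearSolution b c t (T w)
  have hu : ∀ t, SublinearGrowth (u t) := fun t =>
    (sublinearGrowth_solution_sub hg t).comp_continuousLinearMap T
  have hyu : ∀ t p e, y t (p, e) = p + δ * e * κ t + u t (p, e) := fun t p e => by
    simp only [u, hT, linearSolution_of_resonant hbc, hκ]
    ring
  have hlim : ∀ᶠ R : ℝ in atTop, z < R / 4 :=
    (tendsto_id.atTop_div_const (by norm_num : (0 : ℝ) < 4)).eventually_gt_atTop z
  have hsmall : ∀ᶠ R : ℝ in atTop, ∀ t ∈ Finset.range N, ∀ w : ℝ × ℝ, ‖w‖ ≤ R →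
      |u t w| ≤ 1 / 4 * R :=
    (eventually_all_finset _).2 fun t _ => hu t (1 / 4) (by norm_num)
  obtain ⟨R, hR, hRz, hR4, hRN⟩ := ((eventually_gt_atTop (0 : ℝ)).and (hlim.and (hsmall.and
    (hu N (δ * |κ N| / 2) (by positivity))))).exists
  simp only [Prod.norm_def, sup_le_iff, Real.norm_eq_abs] at hR4 hRN
  have hRR : |R| ≤ R := (abs_of_pos hR).le
  have hRR' : |-R| ≤ R := by rwa [abs_neg]
  have hN0 : (Finset.range N).Nonempty := Finset.nonempty_range_iff.2 hN.pos.ne'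
  have hdrift : ∀ t ∈ Finset.range N, ∀ e, |e| ≤ R → |δ * e * κ t| ≤ 1 / 2 * R := by
    intro t ht e he
    rw [mul_right_comm, abs_mul, abs_mul, abs_of_pos hδ]
    exact mul_le_mul (hδκ t ht) he (abs_nonneg _) (by norm_num)
  have hend : ∀ p e, |p| ≤ R → |e| ≤ R → |κ N * u N (p, e)| ≤ δ * R * (κ N * κ N) / 2 := by
    intro p e hp he
    rw [abs_mul, ← abs_mul_abs_self (κ N)]
    calc |κ N| * |u N (p, e)| ≤ |κ N| * (δ * |κ N| / 2 * R) := by gcongr; exact hRN _ ⟨hp, he⟩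
      _ = _ := by ring
  have hpos : 0 < δ * R * (κ N * κ N) := mul_pos (mul_pos hδ hR) (mul_self_pos.2 hκN)
  obtain ⟨⟨p, e⟩, h1, h2⟩ := exists_common_zero_of_sign_on_square hR
    (f := fun w => ∑ t ∈ Finset.range N, g t (y t w)) (g := fun w => κ N * (y N w - w.1))
    (continuous_finsetSum _ fun t _ => (hgc t).comp (hyc t))
    (((hyc N).sub continuous_fst).const_mul _)
    (fun e he => Finset.sum_pos (fun t ht => by
      have hy : R / 4 ≤ y t (R, e) := by
        rw [hyu]
        linarith [(abs_le.1 (hdrift t ht e he)).1, (abs_le.1 (hR4 t ht (R, e) ⟨hRR, he⟩)).1]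
      exact pos_of_mul_pos_right (hsign t _ (by linarith [le_abs_self (y t (R, e))]))
        (by linarith)) hN0)
    (fun e he => Finset.sum_neg (fun t ht => by
      have hy : y t (-R, e) ≤ -(R / 4) := by
        rw [hyu]
        linarith [(abs_le.1 (hdrift t ht e he)).2, (abs_le.1 (hR4 t ht (-R, e) ⟨hRR', he⟩)).2]
      exact neg_of_mul_pos_right (hsign t _ (by linarith [neg_le_abs (y t (-R, e))]))
        (by linarith)) hN0)
    (fun p hp => by
      simp only [hyu]
      linarith [(abs_le.1 (hend p R hp hRR)).1])
    (fun p hp => by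
      simp only [hyu]
      linarith [(abs_le.1 (hend p (-R) hp hRR')).2])
  have hyN : y N (p, e) = (T (p, e)).1 := by
    rw [hT]
    linarith [(mul_eq_zero.1 h2).resolve_left hκN]
  refine ⟨T (p, e), hyN, ?_⟩
  have hsum := sum_range_solution_of_resonant hbc g (T (p, e)) N
  have hyN' : solution b c g (T (p, e)) N = (T (p, e)).1 := hyN
  have h1' : ∑ t ∈ Finset.range N, g t (solution b c g (T (p, e)) t) = 0 := h1
  rw [h1', hyN', sub_self, mul_zero] at hsum
  linarith

/-- Theorem 3.4 of Rodríguez–Etheridge, as contained in Theorem 3.1: Let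
`N > 1` be odd, `c ≠ 0`, `g` continuous in `x` and `N`-periodic in `t`, with:
(i) `g` sublinear: `|g(t,x)| ≤ M₁|x|^β + M₂` with `0 ≤ β < 1`;
(ii) `x·g(t,x) > 0` for `|x| > ẑ`;
(iii) if `N·arccos(−b/2)` is an integer multiple of `2π`, then `c ≠ 1` or `|b| ≥ 2`.
Then `y(t+2) + b y(t+1) + c y(t) = g(t, y(t))` has an `N`-periodic solution. -/
theorem periodic_solution_sublinear
    (N : ℕ) (hN : 1 < N) (hNodd : Odd N) (b c : ℝ) (hc : c ≠ 0)
    (g : ℕ → ℝ → ℝ) (hgcont : ∀ t : ℕ, Continuous (g t))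
    (hgper : ∀ (t : ℕ) (x : ℝ), g (t + N) x = g t x)
    (M₁ M₂ β : ℝ) (hM₁ : 0 ≤ M₁) (hM₂ : 0 ≤ M₂) (hβ0 : 0 ≤ β) (hβ1 : β < 1)
    (hgrow : ∀ (t : ℕ) (x : ℝ), |g t x| ≤ M₁ * |x| ^ β + M₂)
    (z : ℝ) (hz : 0 < z)
    (hsign : ∀ (t : ℕ) (x : ℝ), z < |x| → 0 < x * g t x)
    (hres : (∃ k : ℤ, (N : ℝ) * Real.arccos (-b / 2) = 2 * Real.pi * k) →
      (c ≠ 1 ∨ 2 ≤ |b|)) :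
    ∃ y : ℕ → ℝ, (∀ t : ℕ, y (t + N) = y t) ∧
      ∀ t : ℕ, y (t + 2) + b * y (t + 1) + c * y t = g t (y t) := by
  have hg : ∀ t, SublinearGrowth (g t) := fun t =>
    .of_le_rpow hM₁ hβ0 hβ1 (hgrow t)
  obtain ⟨v, h0, h1⟩ : ∃ v, solution b c g v N = v.1 ∧ solution b c g v (N + 1) = v.2 := by
    by_cases hbc : 1 + b + c = 0
    · exact exists_periodic_initial_data_of_resonant hNodd hbc hgcont hg hsign
    · exact exists_periodic_initial_data_of_nonresonant
        (fun _ => pow_ne_one_of_quadratic_root hNodd hbc hres) hgcont hg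
  exact ⟨solution b c g v, solution_periodic hgper h0 h1, solution_recurrence b c g v⟩
end
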